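/- arXiv:1208.0947 — 5 statements merged into one kernel-verified Lean document; each statement's English description precedes it below -/
import Mathlib

section
/- Let S : Fin 2 × Fin 2 × Fin 2 × Fin 2 → ℂ, written S_{αβ̄μν̄}, satisfy the symmetry conditions S_{αβ̄μν̄} = S_{μβ̄αν̄} = S_{μν̄αβ̄}, the Hermitian condition S_{αβ̄μν̄} = conj(S_{βᾱνμ̄}), and the trace condition Σ_{μ=1}^{2} S_{μμ̄αβ̄} = 0 for all α, β. Set a = S_{1\bar{1}1\bar{1}}, b = 2S_{1\bar{1}1\bar{2}}, c = S_{1\bar{2}1\bar{2}}. Then a is real, and for every ζ = (ζ₁, ζ₂) ∈ ℂ²: Σ_{α,β,μ,ν} S_{αβ̄μν̄} ζ_α \bar{ζ}_β ζ_μ \bar{ζ}_ν = Z(ζ) M(a,b,c) Z(ζ)*, where M(a,b,c) is the 3×3 complex matrix with rows (a, b, c), (\bar{b}, −4a, −b), (\bar{c}, −\bar{b}, a). -/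
open Complex Matrix BigOperators

noncomputable section

/-- The row vector `Z(ζ) = ((ζ₁)², ζ₁ζ₂, (ζ₂)²)`. -/
def Zvec (ζ : Fin 2 → ℂ) : Fin 3 → ℂ := ![ζ 0 ^ 2, ζ 0 * ζ 1, ζ 1 ^ 2]

/-- The matrix `M(a,b,c)` with rows `(a,b,c)`, `(b̄,−4a,−b)`, `(c̄,−b̄,a)`
(with complex parameter `a`). -/
def MabcC (a b c : ℂ) : Matrix (Fin 3) (Fin 3) ℂ :=
  !![a, b, c;
     starRingEnd ℂ b, -4 * a, -b;
     starRingEnd ℂ c, -starRingEnd ℂ b, a]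

theorem stmt_3 (S : Fin 2 → Fin 2 → Fin 2 → Fin 2 → ℂ)
    (hsym1 : ∀ α β μ ν, S α β μ ν = S μ β α ν)
    (hsym2 : ∀ α β μ ν, S α β μ ν = S μ ν α β)
    (hherm : ∀ α β μ ν, S α β μ ν = starRingEnd ℂ (S β α ν μ))
    (htrace : ∀ α β, ∑ μ, S μ μ α β = 0)
    (a b c : ℂ) (ha : a = S 0 0 0 0) (hb : b = 2 * S 0 0 0 1) (hc : c = S 0 1 0 1) :
    starRingEnd ℂ a = a ∧
    ∀ ζ : Fin 2 → ℂ,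
      (∑ α, ∑ β, ∑ μ, ∑ ν,
          S α β μ ν * ζ α * starRingEnd ℂ (ζ β) * ζ μ * starRingEnd ℂ (ζ ν))
        = ∑ i, ∑ j, Zvec ζ i * MabcC a b c i j * starRingEnd ℂ (Zvec ζ j) := by
  have h0000 : starRingEnd ℂ (S 0 0 0 0) = S 0 0 0 0 := (hherm 0 0 0 0).symm
  have h0010 : S 0 0 1 0 = starRingEnd ℂ (S 0 0 0 1) := hherm 0 0 1 0
  have h1010 : S 1 0 1 0 = starRingEnd ℂ (S 0 1 0 1) := hherm 1 0 1 0
  have h0100 : S 0 1 0 0 = S 0 0 0 1 := hsym2 0 1 0 0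
  have h1000 : S 1 0 0 0 = starRingEnd ℂ (S 0 0 0 1) := (hsym2 1 0 0 0).trans h0010
  have trace (α β : Fin 2) : S 1 1 α β = -S 0 0 α β := by
    have h := htrace α β
    rw [Fin.sum_univ_two] at h
    linear_combination h
  have h1100 : S 1 1 0 0 = -S 0 0 0 0 := trace 0 0
  have h0011 : S 0 0 1 1 = -S 0 0 0 0 := (hsym2 0 0 1 1).trans h1100
  have h0110 : S 0 1 1 0 = -S 0 0 0 0 := (hsym1 0 1 1 0).trans h1100
  have h1001 : S 1 0 0 1 = -S 0 0 0 0 := (hsym1 1 0 0 1).trans h0011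
  have h1101 : S 1 1 0 1 = -S 0 0 0 1 := trace 0 1
  have h0111 : S 0 1 1 1 = -S 0 0 0 1 := (hsym2 0 1 1 1).trans h1101
  have h1110 : S 1 1 1 0 = -starRingEnd ℂ (S 0 0 0 1) := by rw [trace 1 0, h0010]
  have h1011 : S 1 0 1 1 = -starRingEnd ℂ (S 0 0 0 1) := (hsym2 1 0 1 1).trans h1110
  have h1111 : S 1 1 1 1 = S 0 0 0 0 := by rw [trace 1 1, h0011, neg_neg]
  subst ha hb hc
  refine ⟨h0000, fun ζ => ?_⟩
  simp only [Fin.sum_univ_two, Fin.sum_univ_three, Zvec, MabcC, h0010, h1010, h0100, h1000,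
    h1100, h0011, h0110, h1001, h1101, h0111, h1110, h1011, h1111, Matrix.of_apply,
    Matrix.cons_val, map_mul, map_pow, map_ofNat]
  ring
end
end

section
/- Let a ∈ ℝ and b ∈ ℂ, and let L(a,b) be the 3×3 complex matrix with rows (a, b, 0), (b/2, −2a, −\bar{b}/2), (0, −\bar{b}, 0). Then: (1) the trace of L(a,b) equals −a; and (2) the rank of L(a,b) is strictly less than 2 if and only if a = 0 and b = 0, in which case L(a,b) is the zero matrix. -/
open Complex Matrix

noncomputable section

/-- The matrix `L(a,b)` with rows `(a, b, 0)`, `(b/2, −2a, −b̄/2)`, `(0, −b̄, 0)`. -/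
def Lmat (a : ℝ) (b : ℂ) : Matrix (Fin 3) (Fin 3) ℂ :=
  !![(a : ℂ), b, 0;
     b / 2, -2 * (a : ℂ), -starRingEnd ℂ b / 2;
     0, -starRingEnd ℂ b, 0]

/-- A nonzero `2 × 2` minor forces the rank to be at least two. -/
theorem Matrix.two_le_rank_of_minor_ne_zero {K m n : Type*} [Field K] [Fintype n]
    (M : Matrix m n K) (r : Fin 2 → m) (c : Fin 2 → n)
    (h : (M.submatrix r c).det ≠ 0) : 2 ≤ M.rank := by
  have hr := rank_of_isUnit _ ((isUnit_iff_isUnit_det _).2 (isUnit_iff_ne_zero.2 h))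
  rw [Fintype.card_fin] at hr
  exact hr ▸ M.rank_submatrix_le r c

theorem stmt_4 (a : ℝ) (b : ℂ) :
    Matrix.trace (Lmat a b) = (-a : ℂ) ∧
    ((Lmat a b).rank < 2 ↔ a = 0 ∧ b = 0) ∧
    (a = 0 → b = 0 → Lmat a b = 0) := by
  have hzero : a = 0 → b = 0 → Lmat a b = 0 := by
    rintro rfl rfl
    ext i j
    fin_cases i <;> fin_cases j <;> simp [Lmat]
  refine ⟨?_, ⟨fun h => ?_, fun h => ?_⟩, hzero⟩
  · simp only [Lmat, trace_fin_three, of_apply, cons_val]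
    ring
  · have hb : b = 0 := by
      by_contra hb
      refine h.not_ge (two_le_rank_of_minor_ne_zero _ ![0, 1] ![1, 2] ?_)
      rw [det_fin_two]
      simp [Lmat, hb]
    refine ⟨?_, hb⟩
    by_contra ha
    refine h.not_ge (two_le_rank_of_minor_ne_zero _ ![0, 1] ![0, 1] ?_)
    rw [det_fin_two]
    simp [Lmat, hb, ha]
  · rw [hzero h.1 h.2, rank_zero]
    norm_num
end
end

section
/- Let a ∈ ℝ and b ∈ ℂ, and let L(a,b) be the 3×3 complex matrix with rows (a, b, 0), (b/2, −2a, −\bar{b}/2), (0, −\bar{b}, 0). Then L(a,b) has rank 3 if and only if a ≠ 0 and b ≠ 0. -/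
open Complex Matrix

noncomputable section

theorem Matrix.rank_eq_card_iff_det_ne_zero {n K : Type*} [Fintype n] [DecidableEq n] [Field K]
    (A : Matrix n n K) : A.rank = Fintype.card n ↔ A.det ≠ 0 := by
  rw [← isUnit_iff_ne_zero, ← isUnit_iff_isUnit_det, ← linearIndependent_rows_iff_isUnit,
    linearIndependent_iff_card_eq_finrank_span, rank_eq_finrank_span_row, Set.finrank, eq_comm]

theorem det_Lmat (a : ℝ) (b : ℂ) : (Lmat a b).det = -(a * starRingEnd ℂ b ^ 2 / 2) := by
  simp [Lmat, det_fin_three]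
  ring

theorem stmt_5 (a : ℝ) (b : ℂ) :
    (Lmat a b).rank = 3 ↔ a ≠ 0 ∧ b ≠ 0 := by
  have h := (Lmat a b).rank_eq_card_iff_det_ne_zero
  rw [Fintype.card_fin] at h
  rw [h, det_Lmat]
  simp
end
end

section
/- Fix a ∈ ℝ with a ≠ 0, and take b = 0; for τ, ρ ∈ ℝ and σ ∈ ℂ let T(τ, ρ, σ) be the 3×3 Hermitian matrix with rows (τ + a, σ, 0), (\bar{σ}, τ + ρ − 4a, σ), (0, \bar{σ}, ρ + a). Then: (1) T(τ, ρ, σ) has rank 1 if and only if σ = 0 and (τ, ρ) is one of (−a, −a), (−a, 5a), (5a, −a); and (2) T(τ, ρ, σ) has rank 1 and is negative semidefinite if and only if either a > 0 and (τ, ρ, σ) = (−a, −a, 0), or a < 0 and (τ, ρ, σ) is one of (−a, 5a, 0), (5a, −a, 0). In particular, when a > 0 there is exactly one such triple and when a < 0 there are exactly two. -/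
open Complex Matrix BigOperators ComplexOrder

noncomputable section

/-- The Hermitian matrix `T(τ, ρ, σ)` (for fixed `a ∈ ℝ`, `b ∈ ℂ`) with rows
`(τ + a, σ + b, 0)`, `(σ̄ + b̄, τ + ρ − 4a, σ − b)`, `(0, σ̄ − b̄, ρ + a)`. -/
def Tmat (a : ℝ) (b : ℂ) (τ ρ : ℝ) (σ : ℂ) : Matrix (Fin 3) (Fin 3) ℂ :=
  !![(τ : ℂ) + a, σ + b, 0;
     starRingEnd ℂ σ + starRingEnd ℂ b, (τ : ℂ) + ρ - 4 * a, σ - b;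
     0, starRingEnd ℂ σ - starRingEnd ℂ b, (ρ : ℂ) + a]

theorem Matrix.mul_eq_mul_of_rank_le_one {m n K : Type*} [Fintype m] [Fintype n] [Field K]
    {A : Matrix m n K} (hA : A.rank ≤ 1) (i j : m) (k l : n) :
    A i k * A j l = A i l * A j k := by
  have hdet : (A.submatrix ![i, j] ![k, l]).det = 0 := by
    by_contra h
    have hfull := rank_of_isUnit _ ((isUnit_iff_isUnit_det _).2 (isUnit_iff_ne_zero.2 h))
    have hle := rank_submatrix_le A ![i, j] ![k, l]
    rw [hfull, Fintype.card_fin] at hle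
    omega
  rw [det_fin_two] at hdet
  simpa [sub_eq_zero] using hdet

theorem Tmat_zero_zero (a τ ρ : ℝ) :
    Tmat a 0 τ ρ 0 =
      diagonal ![((τ + a : ℝ) : ℂ), ((τ + ρ - 4 * a : ℝ) : ℂ), ((ρ + a : ℝ) : ℂ)] := by
  ext i j
  fin_cases i <;> fin_cases j <;> simp [Tmat]

theorem eq_zero_of_rank_Tmat_zero_eq_one {a τ ρ : ℝ} {σ : ℂ} (h : (Tmat a 0 τ ρ σ).rank = 1) :
    σ = 0 := by
  have := mul_eq_mul_of_rank_le_one h.le 0 1 1 2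
  simpa [Tmat] using this

theorem Tmat_zero_zero_rank_eq_one_iff {a : ℝ} (ha : a ≠ 0) (τ ρ : ℝ) :
    (Tmat a 0 τ ρ 0).rank = 1 ↔
      (τ = -a ∧ ρ = -a) ∨ (τ = -a ∧ ρ = 5 * a) ∨ (τ = 5 * a ∧ ρ = -a) := by
  have hcard : (Tmat a 0 τ ρ 0).rank =
      (if τ + a = 0 then 0 else 1) + (if τ + ρ - 4 * a = 0 then 0 else 1) +
        (if ρ + a = 0 then 0 else 1) := by
    rw [Tmat_zero_zero, rank_diagonal, Fintype.card_subtype, Finset.card_filter,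
      Fin.sum_univ_three]
    simp only [cons_val, ne_eq, ofReal_eq_zero, ite_not]
  rw [hcard]
  constructor
  · intro h
    split_ifs at h with h₁ h₂ h₃ h₃ h₂ h₃ h₃ <;> first | omega | skip
    · exact Or.inr (Or.inl ⟨by linarith, by linarith⟩)
    · exact Or.inl ⟨by linarith, by linarith⟩
    · exact Or.inr (Or.inr ⟨by linarith, by linarith⟩)
  · rintro (⟨rfl, rfl⟩ | ⟨rfl, rfl⟩ | ⟨rfl, rfl⟩) <;> ring_nf <;> simp [ha]

theorem neg_Tmat_zero_zero_posSemidef_iff (a τ ρ : ℝ) :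
    (-(Tmat a 0 τ ρ 0)).PosSemidef ↔ τ + a ≤ 0 ∧ τ + ρ - 4 * a ≤ 0 ∧ ρ + a ≤ 0 := by
  rw [Tmat_zero_zero, diagonal_neg, posSemidef_diagonal_iff, Fin.forall_fin_succ,
    Fin.forall_fin_two]
  simp only [Fin.succ_zero_eq_one, Fin.succ_one_eq_two, cons_val, ← ofReal_neg,
    zero_le_real, neg_nonneg]

theorem stmt_13 (a : ℝ) (ha : a ≠ 0) :
    (∀ (τ ρ : ℝ) (σ : ℂ),
      (Tmat a 0 τ ρ σ).rank = 1 ↔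
        σ = 0 ∧ ((τ = -a ∧ ρ = -a) ∨ (τ = -a ∧ ρ = 5 * a) ∨ (τ = 5 * a ∧ ρ = -a))) ∧
    (∀ (τ ρ : ℝ) (σ : ℂ),
      ((Tmat a 0 τ ρ σ).rank = 1 ∧ (-(Tmat a 0 τ ρ σ)).PosSemidef) ↔
        ((0 < a ∧ τ = -a ∧ ρ = -a ∧ σ = 0) ∨
         (a < 0 ∧ ((τ = -a ∧ ρ = 5 * a ∧ σ = 0) ∨ (τ = 5 * a ∧ ρ = -a ∧ σ = 0))))) := by
  have hrank (τ ρ : ℝ) (σ : ℂ) : (Tmat a 0 τ ρ σ).rank = 1 ↔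
      σ = 0 ∧ ((τ = -a ∧ ρ = -a) ∨ (τ = -a ∧ ρ = 5 * a) ∨ (τ = 5 * a ∧ ρ = -a)) := by
    refine ⟨fun h => ?_, ?_⟩
    · obtain rfl := eq_zero_of_rank_Tmat_zero_eq_one h
      exact ⟨rfl, (Tmat_zero_zero_rank_eq_one_iff ha τ ρ).1 h⟩
    · rintro ⟨rfl, h⟩
      exact (Tmat_zero_zero_rank_eq_one_iff ha τ ρ).2 h
  refine ⟨hrank, fun τ ρ σ => ?_⟩
  rw [hrank]
  constructor
  · rintro ⟨⟨rfl, h⟩, hneg⟩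
    rw [neg_Tmat_zero_zero_posSemidef_iff] at hneg
    obtain ⟨h₁, h₂, h₃⟩ := hneg
    rcases h with ⟨rfl, rfl⟩ | ⟨rfl, rfl⟩ | ⟨rfl, rfl⟩
    · exact Or.inl ⟨lt_of_le_of_ne (by linarith) ha.symm, rfl, rfl, rfl⟩
    · exact Or.inr ⟨lt_of_le_of_ne (by linarith) ha, Or.inl ⟨rfl, rfl, rfl⟩⟩
    · exact Or.inr ⟨lt_of_le_of_ne (by linarith) ha, Or.inr ⟨rfl, rfl, rfl⟩⟩
  · rintro (⟨h, rfl, rfl, rfl⟩ | ⟨h, ⟨rfl, rfl, rfl⟩ | ⟨rfl, rfl, rfl⟩⟩) <;>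
      refine ⟨by simp, (neg_Tmat_zero_zero_posSemidef_iff _ _ _).2 ⟨?_, ?_, ?_⟩⟩ <;> linarith
end
end

section
/- Fix a ∈ ℝ and b ∈ ℂ with b ≠ 0; for τ, ρ ∈ ℝ and σ ∈ ℂ let T(τ, ρ, σ) be the 3×3 Hermitian matrix with rows (τ + a, σ + b, 0), (\bar{σ} + \bar{b}, τ + ρ − 4a, σ − b), (0, \bar{σ} − \bar{b}, ρ + a). If T(τ, ρ, σ) has rank 1, then σ = b or σ = −b. -/
open Complex Matrix BigOperators ComplexOrder

noncomputable section

/-- A square submatrix larger than the rank has vanishing determinant. -/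
lemma det_submatrix_eq_zero_of_rank_lt {m n k R : Type*} [Fintype n] [Fintype k] [DecidableEq k]
    [CommRing R] [IsDomain R] (A : Matrix m n R) (r : k → m) (c : k → n)
    (h : A.rank < Fintype.card k) : (A.submatrix r c).det = 0 := by
  by_contra hdet
  have hle := rank_submatrix_le A r c
  rw [rank_of_det_ne_zero hdet] at hle
  exact absurd h hle.not_gt

theorem stmt_14 (a : ℝ) (b : ℂ) (hb : b ≠ 0) (τ ρ : ℝ) (σ : ℂ)
    (hrank : (Tmat a b τ ρ σ).rank = 1) :
    σ = b ∨ σ = -b := by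
  have hminor : (σ + b) * (σ - b) = 0 := by
    have hdet := det_submatrix_eq_zero_of_rank_lt (Tmat a b τ ρ σ)
      (![0, 1] : Fin 2 → Fin 3) ![1, 2] (by simp [hrank])
    rw [det_fin_two] at hdet
    simpa [Tmat] using hdet
  rcases mul_eq_zero.mp hminor with h | h
  · exact Or.inr (eq_neg_of_add_eq_zero_left h)
  · exact Or.inl (sub_eq_zero.mp h)
end
end
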